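/- Let A be a 2×2 real matrix with det A = 1 and t := trace A > 2, and set λ := (t + √(t² − 4))/2 > 1. Then for every real z with |z| < 1/λ, ∑_{n=1}^∞ |det(I − Aⁿ)|·zⁿ/n = 2·log(1 − z) − log(1 − λz) − log(1 − z/λ). Equivalently, the zeta function exp(∑_{n≥1} |det(I − Aⁿ)|·zⁿ/n) equals the rational function (1 − z)²/((1 − λz)(1 − z/λ)) on |z| < 1/λ. -/

import Mathlib

theorem trace_pow_aux (A : Matrix (Fin 2) (Fin 2) ℝ) (hdet : A.det = 1) (l m : ℝ)
    (hs : l + m = A.trace) (hp : l * m = 1) (n : ℕ) :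
    (A ^ n).trace = l ^ n + m ^ n ∧ (A ^ (n + 1)).trace = l ^ (n + 1) + m ^ (n + 1) := by
  have hA : A * A = A.trace • A - 1 := by
    rw [Matrix.det_fin_two] at hdet
    ext i j
    fin_cases i <;> fin_cases j <;>
      simp [Matrix.mul_apply, Fin.sum_univ_two, Matrix.trace_fin_two] <;> linarith
  induction n with
  | zero => simp [hs]; norm_num
  | succ k ih =>
    refine ⟨ih.2, ?_⟩
    have h : A ^ (k + 1 + 1) = A.trace • A ^ (k + 1) - A ^ k := by
      rw [pow_succ, pow_succ, mul_assoc, hA, mul_sub, mul_one, Matrix.mul_smul]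
    rw [h, Matrix.trace_sub, Matrix.trace_smul, ih.1, ih.2, ← hs, smul_eq_mul]
    linear_combination (l ^ k + m ^ k) * hp

theorem zeta_of_hyperbolic_is_rational (A : Matrix (Fin 2) (Fin 2) ℝ)
    (hdet : A.det = 1) (htr : 2 < A.trace)
    (lam : ℝ) (hlam : lam = (A.trace + Real.sqrt (A.trace ^ 2 - 4)) / 2) :
    ∀ z : ℝ, |z| < 1 / lam →
      (∑' n : ℕ, |(1 - A ^ (n + 1)).det| * z ^ (n + 1) / (n + 1) =
          2 * Real.log (1 - z) - Real.log (1 - lam * z) - Real.log (1 - z / lam)) ∧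
        Real.exp (∑' n : ℕ, |(1 - A ^ (n + 1)).det| * z ^ (n + 1) / (n + 1)) =
          (1 - z) ^ 2 / ((1 - lam * z) * (1 - z / lam)) := by
  intro z hz
  have hsq : Real.sqrt (A.trace ^ 2 - 4) ^ 2 = A.trace ^ 2 - 4 :=
    Real.sq_sqrt (by nlinarith)
  have hs0 := Real.sqrt_nonneg (A.trace ^ 2 - 4)
  have hl1 : 1 < lam := by rw [hlam]; linarith
  have hl0 : 0 < lam := by linarith
  have hq : lam * (A.trace - lam) = 1 := by
    rw [hlam]; linear_combination (-1 / 4) * hsq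
  have hinv : lam⁻¹ = A.trace - lam := by
    rw [inv_eq_iff_eq_inv]; exact eq_inv_of_mul_eq_one_left hq
  have hp : lam * lam⁻¹ = 1 := mul_inv_cancel₀ hl0.ne'
  have hD : ∀ n : ℕ, |(1 - A ^ n).det| = lam ^ n + lam⁻¹ ^ n - 2 := by
    intro n
    have ht := (trace_pow_aux A hdet lam lam⁻¹ (by rw [hinv]; ring) hp n).1
    have hd : (A ^ n).det = 1 := by rw [Matrix.det_pow, hdet, one_pow]
    have h1 : (1 - A ^ n).det = 2 - (lam ^ n + lam⁻¹ ^ n) := by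
      rw [← ht]
      rw [Matrix.det_fin_two] at hd ⊢
      simp [Matrix.trace_fin_two]
      linarith
    have hpn : lam ^ n * lam⁻¹ ^ n = 1 := by rw [← mul_pow, hp, one_pow]
    have ha : 0 < lam ^ n := by positivity
    have hb : 0 < lam⁻¹ ^ n := by positivity
    rw [h1, abs_of_nonpos]
    · ring
    · nlinarith [sq_nonneg (lam ^ n - lam⁻¹ ^ n)]
  have hz1 : |lam * z| < 1 := by
    rw [abs_mul, abs_of_pos hl0, mul_comm]; exact (lt_div_iff₀ hl0).1 hz
  have hz2 : |z| < 1 := hz.trans ((div_lt_one hl0).2 hl1)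
  have hz3 : |z / lam| < 1 := by
    rw [abs_div, abs_of_pos hl0, div_lt_one hl0]; linarith
  have H := ((Real.hasSum_pow_div_log_of_abs_lt_one hz1).add
    (Real.hasSum_pow_div_log_of_abs_lt_one hz3)).sub
    ((Real.hasSum_pow_div_log_of_abs_lt_one hz2).mul_left 2)
  have hsum : ∑' n : ℕ, |(1 - A ^ (n + 1)).det| * z ^ (n + 1) / (n + 1) =
          2 * Real.log (1 - z) - Real.log (1 - lam * z) - Real.log (1 - z / lam) := by
    have h2 : ∀ n : ℕ, |(1 - A ^ (n + 1)).det| * z ^ (n + 1) / ((n : ℝ) + 1) =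
        (lam * z) ^ (n + 1) / ((n : ℝ) + 1) + (z / lam) ^ (n + 1) / ((n : ℝ) + 1)
          - 2 * (z ^ (n + 1) / ((n : ℝ) + 1)) := by
      intro n
      rw [hD, div_eq_mul_inv z lam, mul_pow, mul_pow]
      ring
    rw [tsum_congr h2, H.tsum_eq]
    ring
  refine ⟨hsum, ?_⟩
  have p1 : 0 < 1 - lam * z := by linarith [(abs_lt.1 hz1).2]
  have p2 : 0 < 1 - z := by linarith [(abs_lt.1 hz2).2]
  have p3 : 0 < 1 - z / lam := by linarith [(abs_lt.1 hz3).2]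
  rw [hsum, Real.exp_sub, Real.exp_sub, Real.exp_log p1, Real.exp_log p3, two_mul,
    Real.exp_add, Real.exp_log p2, div_div, sq]
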